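/- arXiv:2201.05822 — 2 statements merged into one kernel-verified Lean document; each statement's English description precedes it below -/
import Mathlib

section
/- For complex s with Re(s) > 1, (1/(2πi)) ∫_{Re z = 1/2} π² z^{1-s}/sin²(π z) dz = (s-1) ζ(s), where the line is traversed upwards and z^{1-s} is the principal branch. -/
open Real Complex MeasureTheory

lemma sinh_sq_ge (x : ℝ) : x ^ 2 ≤ Real.sinh x ^ 2 := by
  rw [← sq_abs x, ← sq_abs (Real.sinh x), Real.abs_sinh]
  exact pow_le_pow_left₀ (abs_nonneg _) (Real.self_le_sinh_iff.2 (abs_nonneg _)) 2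

noncomputable def Wt (y : ℝ) : ℝ := ((Real.cosh (π * y)) ^ 2)⁻¹

lemma Wt_cont : Continuous Wt := by
  unfold Wt
  exact Continuous.inv₀ (by fun_prop) fun y => by have := Real.cosh_pos (π * y); positivity

lemma Wt_nonneg (y : ℝ) : 0 ≤ Wt y := by unfold Wt; positivity

lemma pi_sq_ge (y : ℝ) : y ^ 2 ≤ (π * y) ^ 2 := by
  have := Real.pi_gt_three
  rw [mul_pow]
  have h1 : 1 ≤ π ^ 2 := by nlinarith
  nlinarith [sq_nonneg y]

lemma Wt_le (y : ℝ) : Wt y ≤ (1 + y ^ 2)⁻¹ := by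
  unfold Wt
  apply inv_anti₀ (by positivity)
  rw [Real.cosh_sq]
  linarith [sinh_sq_ge (π * y), pi_sq_ge y]

lemma Wt_int : Integrable Wt :=
  integrable_inv_one_add_sq.mono' Wt_cont.aestronglyMeasurable
    (Filter.Eventually.of_forall fun y => by
      rw [Real.norm_of_nonneg (Wt_nonneg y)]; exact Wt_le y)

lemma tanh_top : Filter.Tendsto Real.tanh Filter.atTop (nhds 1) := by
  have h : Filter.Tendsto (fun x => Real.exp (-x) / Real.cosh x) Filter.atTop (nhds 0) := by
    refine squeeze_zero (fun x => ?_) (fun x => ?_) Real.tendsto_exp_neg_atTop_nhds_zero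
    · have := Real.cosh_pos x
      positivity
    · exact div_le_self (Real.exp_pos _).le (Real.one_le_cosh x)
  have h2 := h.const_sub 1
  rw [sub_zero] at h2
  refine h2.congr fun x => ?_
  have := Real.cosh_pos x
  rw [Real.tanh_eq_sinh_div_cosh, ← Real.cosh_sub_sinh]
  field_simp
  ring

lemma tanh_bot : Filter.Tendsto Real.tanh Filter.atBot (nhds (-1)) := by
  have := (tanh_top.comp Filter.tendsto_neg_atBot_atTop).neg
  refine this.congr fun x => ?_
  simp

lemma Wt_integral : ∫ y, Wt y = 2 / π := by
  have hd : ∀ y : ℝ, HasDerivAt (fun y => Real.tanh (π * y) / π) (Wt y) y := by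
    intro y
    have h0 : HasDerivAt (fun y : ℝ => π * y) π y := by
      simpa using (hasDerivAt_id y).const_mul π
    have hc := Real.cosh_pos (π * y)
    have h1 := ((h0.sinh).div (h0.cosh) hc.ne').div_const π
    have := h1.congr_of_eventuallyEq (f₁ := fun y => Real.tanh (π * y) / π)
      (Filter.Eventually.of_forall fun y => by simp [Real.tanh_eq_sinh_div_cosh])
    refine this.congr_deriv ?_
    unfold Wt
    have := Real.cosh_sq (π * y)
    have hp := Real.pi_pos
    field_simp
    linarith
  have := integral_of_hasDerivAt_of_tendsto hd Wt_int
    ((tanh_bot.comp (Filter.tendsto_id.const_mul_atBot Real.pi_pos)).div_const π)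
    ((tanh_top.comp (Filter.tendsto_id.const_mul_atTop Real.pi_pos)).div_const π)
  rw [this]; ring

lemma sin_half (y : ℝ) : ((Complex.sin (π * ((1 / 2 : ℂ) + y * I))) ^ 2)⁻¹ = (Wt y : ℂ) := by
  have : (π : ℂ) * ((1 / 2 : ℂ) + y * I) = (π * y : ℂ) * I + π / 2 := by ring
  rw [this, Complex.sin_add_pi_div_two, Complex.cos_mul_I]
  simp [Wt]

lemma sin_neg_half (y : ℝ) : ((Complex.sin (π * ((-1 / 2 : ℂ) + y * I))) ^ 2)⁻¹ = (Wt y : ℂ) := by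
  have : (π : ℂ) * ((-1 / 2 : ℂ) + y * I) = (π * y : ℂ) * I - π / 2 := by ring
  rw [this, Complex.sin_sub_pi_div_two, Complex.cos_mul_I]
  simp [Wt]

lemma sin_norm_ge (z : ℂ) : z.im ^ 2 ≤ ‖Complex.sin (π * z)‖ ^ 2 := by
  have h : ‖Complex.sin (π * z)‖ ^ 2 = Real.sin (π * z.re) ^ 2 + Real.sinh (π * z.im) ^ 2 := by
    rw [Complex.sin_eq, Complex.sq_norm, Complex.normSq_apply]
    simp only [Complex.re_ofReal_mul, Complex.im_ofReal_mul]
    rw [← ofReal_sin, ← ofReal_cos, ← ofReal_sinh, ← ofReal_cosh]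
    simp only [add_re, mul_re, mul_im, add_im, ofReal_re, ofReal_im, I_re, I_im]
    have h1 := Real.sin_sq_add_cos_sq (π * z.re)
    have h2 := Real.cosh_sq (π * z.im)
    have h3 : Real.cos (π * z.re) ^ 2 = 1 - Real.sin (π * z.re) ^ 2 := by linarith
    ring_nf
    ring_nf at h2 h3
    rw [h2, h3]
    ring
  rw [h]
  nlinarith [sinh_sq_ge (π * z.im), pi_sq_ge z.im, sq_nonneg (Real.sin (π * z.re))]

lemma key (F : ℂ → ℂ) (M : ℝ) (hF : DifferentiableOn ℂ F {z | |z.re| < 1})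
    (hM : ∀ z : ℂ, |z.re| ≤ 1 / 2 → ‖F z‖ ≤ M) :
    ∫ y : ℝ, (F ((1 / 2 : ℂ) + y * I) - F ((-1 / 2 : ℂ) + y * I)) * (Wt y : ℂ)
      = 2 / π * deriv F 0 := by
  set U : Set ℂ := {z | |z.re| < 1} with hU
  have hUo : IsOpen U := isOpen_lt (by fun_prop) continuous_const
  have h0U : U ∈ nhds (0 : ℂ) := hUo.mem_nhds (by simp [hU])
  set k : ℂ → ℂ := dslope (dslope F 0) 0 with hk
  set S : ℂ → ℂ := dslope (fun z : ℂ => Complex.sin (π * z)) 0 with hS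
  have hkd : DifferentiableOn ℂ k U := by
    rw [hk, Complex.differentiableOn_dslope h0U, Complex.differentiableOn_dslope h0U]
    exact hF
  have hSd : DifferentiableOn ℂ S U := by
    rw [hS, Complex.differentiableOn_dslope h0U]
    have : Differentiable ℂ (fun z : ℂ => Complex.sin (π * z)) := by fun_prop
    exact this.differentiableOn
  have hSz : ∀ z, z * S z = Complex.sin (π * z) := by
    intro z
    have := sub_smul_dslope (fun z : ℂ => Complex.sin (π * z)) 0 z
    simpa using this
  have hkz : ∀ z, z ^ 2 * k z = F z - F 0 - deriv F 0 * z := by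
    intro z
    have h1 := sub_smul_dslope F 0 z
    have h2 := sub_smul_dslope (dslope F 0) 0 z
    simp only [sub_zero, smul_eq_mul, dslope_same] at h1 h2
    rw [← h1, hk, pow_two, mul_assoc, h2]
    ring
  have hpi : (π : ℂ) ≠ 0 := by exact_mod_cast Real.pi_ne_zero
  have hS0 : ∀ z ∈ U, S z ≠ 0 := by
    intro z hz h
    by_cases hz0 : z = 0
    · subst hz0
      have hd : HasDerivAt (fun z : ℂ => Complex.sin (π * z)) π 0 := by
        have h0 : HasDerivAt (fun z : ℂ => (π : ℂ) * z) π 0 := by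
          simpa using (hasDerivAt_id (0 : ℂ)).const_mul (π : ℂ)
        simpa using h0.csin
      rw [hS, dslope_same, hd.deriv] at h
      exact hpi h
    · have h1 := hSz z
      rw [h, mul_zero, eq_comm, Complex.sin_eq_zero_iff] at h1
      obtain ⟨m, hm⟩ := h1
      have hzm : z = m := by
        rw [mul_comm] at hm
        exact mul_right_cancel₀ hpi hm
      rw [hzm] at hz
      simp only [hU, Set.mem_ofPred_eq, intCast_re] at hz
      have : |m| < 1 := by exact_mod_cast hz
      rw [Int.abs_lt_one_iff] at this
      apply hz0
      rw [hzm, this]; simp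
  set H : ℂ → ℂ := fun z => k z / S z ^ 2 with hH
  have hHd : DifferentiableOn ℂ H U :=
    hkd.div (hSd.pow 2) fun z hz => pow_ne_zero 2 (hS0 z hz)
  have hHz : ∀ z, z ≠ 0 → H z = (F z - F 0 - deriv F 0 * z) * ((Complex.sin (π * z)) ^ 2)⁻¹ := by
    intro z hz
    rw [← hkz, ← hSz, hH]
    field_simp
  have hM0 : 0 ≤ M := (norm_nonneg _).trans (hM 0 (by simp))
  -- bound on horizontal
  have hHb : ∀ z : ℂ, |z.re| ≤ 1 / 2 → 1 ≤ |z.im| →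
      ‖H z‖ ≤ (2 * M + ‖deriv F 0‖ * 2) * |z.im|⁻¹ := by
    intro z hz1 hz2
    have hz : z ≠ 0 := by rintro rfl; simp at hz2; linarith
    have hpos : 0 < |z.im| := by linarith
    rw [hHz z hz, norm_mul, norm_inv, norm_pow]
    have hs := sin_norm_ge z
    rw [← sq_abs] at hs
    have h3 : (‖Complex.sin (π * z)‖ ^ 2)⁻¹ ≤ (|z.im| ^ 2)⁻¹ := inv_anti₀ (by positivity) hs
    have hzn : ‖z‖ ≤ 2 * |z.im| := (Complex.norm_le_abs_re_add_abs_im z).trans (by linarith)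
    have h4 : ‖F z - F 0 - deriv F 0 * z‖ ≤ (2 * M + ‖deriv F 0‖ * 2) * |z.im| := by
      calc _ ≤ ‖F z‖ + ‖F 0‖ + ‖deriv F 0‖ * ‖z‖ := by
            rw [← norm_mul]
            exact (norm_sub_le _ _).trans (by gcongr; exact norm_sub_le _ _)
        _ ≤ M + M + ‖deriv F 0‖ * (2 * |z.im|) := by
            gcongr
            · exact hM z hz1
            · exact hM 0 (by simp)
        _ ≤ _ := by nlinarith
    calc _ ≤ ((2 * M + ‖deriv F 0‖ * 2) * |z.im|) * (|z.im| ^ 2)⁻¹ := by gcongr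
      _ = _ := by field_simp
  have hline : ∀ a : ℝ, |a| < 1 → ∀ f : ℂ → ℂ, DifferentiableOn ℂ f U →
      Continuous (fun y : ℝ => f (a + y * I)) := by
    intro a ha f hf
    refine hf.continuousOn.comp_continuous (by fun_prop) fun y => ?_
    simpa [hU] using ha
  have e1 : ((1 / 2 : ℝ) : ℂ) = 1 / 2 := by push_cast; rfl
  have e2 : ((-1 / 2 : ℝ) : ℂ) = -1 / 2 := by push_cast; rfl
  have a1 : |(1 / 2 : ℝ)| < 1 := by rw [abs_lt]; constructor <;> norm_num
  have a2 : |(-1 / 2 : ℝ)| < 1 := by rw [abs_lt]; constructor <;> norm_num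
  have cF1 := hline _ a1 F hF
  have cF2 := hline _ a2 F hF
  have cH1 := hline _ a1 H hHd
  have cH2 := hline _ a2 H hHd
  rw [e1] at cF1 cH1
  rw [e2] at cF2 cH2
  -- difference on vertical lines
  set G : ℝ → ℂ := fun y => (F ((1 / 2 : ℂ) + y * I) - F ((-1 / 2 : ℂ) + y * I)) * (Wt y : ℂ)
    with hG
  have cW : Continuous (fun y => (Wt y : ℂ)) := continuous_ofReal.comp Wt_cont
  have cG : Continuous G := (cF1.sub cF2).mul cW
  have iG : Integrable G := by
    refine (Wt_int.const_mul (2 * M)).mono' cG.aestronglyMeasurable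
      (Filter.Eventually.of_forall fun y => ?_)
    rw [hG]
    simp only [norm_mul, Complex.norm_real, Real.norm_of_nonneg (Wt_nonneg y)]
    refine mul_le_mul_of_nonneg_right ?_ (Wt_nonneg y)
    refine (norm_sub_le _ _).trans ?_
    have b1 := hM ((1 / 2 : ℂ) + y * I) (by rw [← e1]; simp [abs_le])
    have b2 := hM ((-1 / 2 : ℂ) + y * I) (by
      rw [← e2]
      simp only [add_re, ofReal_re, mul_re, I_re, mul_zero, ofReal_im, I_im, mul_one, sub_self,
        add_zero]
      rw [abs_le]; constructor <;> norm_num)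
    linarith
  have hdiff : ∀ y : ℝ, H ((1 / 2 : ℂ) + y * I) - H ((-1 / 2 : ℂ) + y * I)
      = G y - deriv F 0 * (Wt y : ℂ) := by
    intro y
    have n1 : (1 / 2 : ℂ) + y * I ≠ 0 := by
      intro h
      have := congrArg Complex.re h
      rw [← e1] at this
      simp at this
    have n2 : (-1 / 2 : ℂ) + y * I ≠ 0 := by
      intro h
      have := congrArg Complex.re h
      rw [← e2] at this
      simp at this
    rw [hHz _ n1, hHz _ n2, sin_half, sin_neg_half, hG]
    ring
  have iW : Integrable (fun y => (Wt y : ℂ)) := Wt_int.ofReal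
  have iGW : Integrable (fun y => G y - deriv F 0 * (Wt y : ℂ)) := iG.sub (iW.const_mul _)
  have lim1 := intervalIntegral_tendsto_integral iGW Filter.tendsto_neg_atTop_atBot Filter.tendsto_id
  have rect : ∀ T : ℝ, I * ∫ y in (-T)..T, (G y - deriv F 0 * (Wt y : ℂ)) =
      (∫ x in (-1/2 : ℝ)..(1/2), H (x + T * I)) - ∫ x in (-1/2 : ℝ)..(1/2), H (x + (-T : ℝ) * I) := by
    intro T
    have := Complex.integral_boundary_rect_eq_zero_of_differentiableOn H
      (⟨-1/2, -T⟩ : ℂ) (⟨1/2, T⟩ : ℂ) (hHd.mono ?_)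
    · simp only [smul_eq_mul] at this
      rw [e1, e2] at this
      simp_rw [← hdiff]
      rw [intervalIntegral.integral_sub (cH1.intervalIntegrable _ _) (cH2.intervalIntegrable _ _)]
      linear_combination this
    · intro z hz
      rw [mem_reProdIm] at hz
      have h1 := hz.1
      rw [Set.uIcc_of_le (by norm_num)] at h1
      simp only [hU, Set.mem_ofPred_eq, abs_lt]
      constructor <;> linarith [h1.1, h1.2]
  have horiz : ∀ T : ℝ, 1 ≤ |T| → ‖∫ x in (-1/2 : ℝ)..(1/2), H (x + T * I)‖ ≤
      (2 * M + ‖deriv F 0‖ * 2) * |T|⁻¹ := by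
    intro T hT
    have := intervalIntegral.norm_integral_le_of_norm_le_const (a := -1/2) (b := 1/2)
      (f := fun x : ℝ => H (x + T * I)) (C := (2 * M + ‖deriv F 0‖ * 2) * |T|⁻¹) ?_
    · norm_num at this ⊢
      exact this
    · intro x hx
      rw [Set.uIoc_of_le (by norm_num)] at hx
      have := hHb (x + T * I) (by simp [abs_le]; constructor <;> linarith [hx.1, hx.2])
        (by simpa using hT)
      simpa using this
  have lim2 : Filter.Tendsto (fun T : ℝ => I * ∫ y in (-T)..T, (G y - deriv F 0 * (Wt y : ℂ)))
      Filter.atTop (nhds 0) := by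
    have hz : Filter.Tendsto (fun T : ℝ => 2 * (2 * M + ‖deriv F 0‖ * 2) * T⁻¹) Filter.atTop
        (nhds 0) := by
      simpa using tendsto_inv_atTop_zero.const_mul (2 * (2 * M + ‖deriv F 0‖ * 2))
    refine squeeze_zero_norm' ?_ hz
    filter_upwards [Filter.eventually_ge_atTop 1] with T hT
    have hT' : |T| = T := abs_of_nonneg (by linarith)
    rw [rect T]
    refine (norm_sub_le _ _).trans ?_
    have b1 := horiz T (by rw [hT']; exact hT)
    have b2 := horiz (-T) (by rw [abs_neg, hT']; exact hT)
    rw [abs_neg] at b2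
    rw [hT'] at b1 b2
    linarith
  have lim3 := tendsto_nhds_unique (lim1.const_mul I) lim2
  have lim4 : ∫ y, (G y - deriv F 0 * (Wt y : ℂ)) = 0 := by simpa using lim3
  rw [integral_sub iG (iW.const_mul _), integral_const_mul, integral_complex_ofReal, Wt_integral] at lim4
  push_cast at lim4
  linear_combination lim4

lemma cpow_bound (s : ℂ) (hs : 1 < s.re) (a : ℝ) (ha : 0 < a) (z : ℂ) (hz : a ≤ z.re) :
    ‖z ^ (1 - s)‖ ≤ a ^ (1 - s.re) * Real.exp (π * |s.im|) := by
  have hzn : a ≤ ‖z‖ := hz.trans (Complex.re_le_norm z)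
  refine (Complex.norm_cpow_le _ _).trans ?_
  rw [div_eq_mul_inv, ← Real.exp_neg]
  have h1 : ‖z‖ ^ (1 - s).re ≤ a ^ (1 - s.re) := by
    simp only [sub_re, one_re]
    exact Real.rpow_le_rpow_of_nonpos ha hzn (by linarith)
  have h2 : -(z.arg * (1 - s).im) ≤ π * |s.im| := by
    refine (le_abs_self _).trans ?_
    rw [abs_neg, abs_mul]
    have : |(1 - s).im| = |s.im| := by simp
    rw [this]
    gcongr
    exact Complex.abs_arg_le_pi z
  gcongr

theorem stmt_11 (s : ℂ) (hs : 1 < s.re) :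
    (1 / (2 * π * Complex.I)) * (∫ y : ℝ, Complex.I *
        ((π : ℂ) ^ 2 * ((1 / 2 : ℂ) + y * Complex.I) ^ (1 - s) /
          (Complex.sin (π * ((1 / 2 : ℂ) + y * Complex.I))) ^ 2)) =
      (s - 1) * riemannZeta s := by
  have hpi : (π : ℂ) ≠ 0 := by exact_mod_cast Real.pi_ne_zero
  set J : ℕ → ℂ := fun n => ∫ y : ℝ, ((n : ℂ) + 1 / 2 + y * I) ^ (1 - s) * (Wt y : ℂ) with hJ
  have cW : Continuous (fun y => (Wt y : ℂ)) := continuous_ofReal.comp Wt_cont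
  have re1 : ∀ (n : ℕ) (y : ℝ), ((n : ℂ) + 1 / 2 + y * I).re = n + 1 / 2 := by
    intro n y
    have : ((n : ℂ) + 1 / 2 + y * I) = (((n : ℝ) + 1 / 2 : ℝ) : ℂ) + y * I := by push_cast; ring
    rw [this]; simp
  have bd : ∀ (n : ℕ) (y : ℝ), ‖((n : ℂ) + 1 / 2 + y * I) ^ (1 - s) * (Wt y : ℂ)‖ ≤
      (((n : ℝ) + 1 / 2) ^ (1 - s.re) * Real.exp (π * |s.im|)) * Wt y := by
    intro n y
    rw [norm_mul, Complex.norm_real, Real.norm_of_nonneg (Wt_nonneg y)]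
    exact mul_le_mul_of_nonneg_right
      (cpow_bound s hs _ (by positivity) _ (re1 n y).ge) (Wt_nonneg y)
  have hint : ∀ n : ℕ, Integrable
      (fun y : ℝ => ((n : ℂ) + 1 / 2 + y * I) ^ (1 - s) * (Wt y : ℂ)) := by
    intro n
    refine (Wt_int.const_mul _).mono' (Continuous.aestronglyMeasurable ?_)
      (Filter.Eventually.of_forall (bd n))
    refine Continuous.mul (Continuous.cpow (by fun_prop) continuous_const fun y => ?_) cW
    left
    rw [re1]; positivity
  have step : ∀ n : ℕ, J n - J (n + 1) = 2 / π * ((s - 1) * (1 / ((n : ℂ) + 1) ^ s)) := by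
    intro n
    have hslit : ∀ z : ℂ, |z.re| < 1 → (n : ℂ) + 1 + z ∈ slitPlane := by
      intro z hz
      left
      have := (abs_lt.1 hz).1
      simp only [add_re, natCast_re, one_re]
      have hn : (0 : ℝ) ≤ n := n.cast_nonneg
      linarith
    have hd : ∀ z : ℂ, |z.re| < 1 → HasDerivAt (fun z : ℂ => ((n : ℂ) + 1 + z) ^ (1 - s))
        ((1 - s) * ((n : ℂ) + 1 + z) ^ (1 - s - 1)) z := by
      intro z hz
      have := ((hasDerivAt_id z).const_add ((n : ℂ) + 1)).cpow_const (c := 1 - s) (hslit z hz)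
      simpa using this
    have hk := key (fun z : ℂ => ((n : ℂ) + 1 + z) ^ (1 - s))
      ((1 / 2 : ℝ) ^ (1 - s.re) * Real.exp (π * |s.im|))
      (fun z hz => (hd z hz).differentiableAt.differentiableWithinAt)
      (fun z hz => cpow_bound s hs _ (by norm_num) _ (by
        have := (abs_le.1 hz).1
        simp only [add_re, natCast_re, one_re]
        have hn : (0 : ℝ) ≤ n := n.cast_nonneg
        linarith))
    rw [(hd 0 (by simp)).deriv] at hk
    have e : ((n : ℂ) + 1 + 0) ^ (1 - s - 1) = 1 / ((n : ℂ) + 1) ^ s := by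
      rw [add_zero, show 1 - s - 1 = -s by ring, Complex.cpow_neg, one_div]
    rw [e] at hk
    have : J (n + 1) - J n = 2 / π * ((1 - s) * (1 / ((n : ℂ) + 1) ^ s)) := by
      rw [← hk, hJ]
      simp only
      rw [← integral_sub (hint (n + 1)) (hint n)]
      congr 1
      ext y
      rw [sub_mul]
      have q1 : (n : ℂ) + 1 + (1 / 2 + y * I) = ((n + 1 : ℕ) : ℂ) + 1 / 2 + y * I := by
        push_cast; ring
      have q2 : (n : ℂ) + 1 + (-1 / 2 + y * I) = (n : ℂ) + 1 / 2 + y * I := by ring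
      rw [q1, q2]
    linear_combination -this
  have Jlim : Filter.Tendsto J Filter.atTop (nhds 0) := by
    have hz : Filter.Tendsto (fun n : ℕ =>
        (((n : ℝ) + 1 / 2) ^ (1 - s.re) * Real.exp (π * |s.im|)) * (2 / π))
        Filter.atTop (nhds 0) := by
      have h1 : Filter.Tendsto (fun n : ℕ => ((n : ℝ) + 1 / 2)) Filter.atTop Filter.atTop :=
        Filter.tendsto_atTop_add_const_right _ _ tendsto_natCast_atTop_atTop
      have h2 := (tendsto_rpow_neg_atTop (y := s.re - 1) (by linarith)).comp h1
      have h3 := (h2.mul_const (Real.exp (π * |s.im|))).mul_const (2 / π)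
      simpa [Function.comp_def] using h3
    refine squeeze_zero_norm (fun n => ?_) hz
    rw [← Wt_integral, ← integral_const_mul]
    exact norm_integral_le_of_norm_le (Wt_int.const_mul _) (Filter.Eventually.of_forall (bd n))
  have hsum : Summable (fun n : ℕ => 1 / ((n : ℂ) + 1) ^ s) := by
    have := (summable_nat_add_iff 1).2 (Complex.summable_one_div_nat_cpow.2 hs)
    simpa using this
  have hS := hsum.hasSum
  rw [← zeta_eq_tsum_one_div_nat_add_one_cpow hs] at hS
  have l1 := ((hS.mul_left (s - 1)).mul_left (2 / (π : ℂ))).tendsto_sum_nat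
  have l2 : Filter.Tendsto (fun N : ℕ => J 0 - J N) Filter.atTop (nhds (J 0 - 0)) :=
    Jlim.const_sub _
  have l3 := tendsto_nhds_unique (l1.congr fun N => by
    rw [← Finset.sum_range_sub' J N]
    exact Finset.sum_congr rfl fun n _ => (step n).symm) l2
  have fin : (∫ y : ℝ, Complex.I *
        ((π : ℂ) ^ 2 * ((1 / 2 : ℂ) + y * Complex.I) ^ (1 - s) /
          (Complex.sin (π * ((1 / 2 : ℂ) + y * Complex.I))) ^ 2)) = I * π ^ 2 * J 0 := by
    rw [hJ]
    simp only
    rw [← integral_const_mul]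
    congr 1
    ext y
    rw [div_eq_mul_inv, sin_half]
    simp only [Nat.cast_zero, zero_add]
    ring
  rw [fin]
  rw [sub_zero] at l3
  rw [← l3]
  have := I_ne_zero
  field_simp
end

section
/- For complex s with Re(s) > 1 and integer N ≥ 1, (1/(2πi)) [∫_{Re z = 1/2} − ∫_{Re z = N + 1/2}] π² z^{1-s}/sin²(π z) dz = (s-1) ∑_{n=1}^N n^{-s}, and the integral over Re z = N + 1/2 tends to 0 as N → ∞. -/
open Real Complex MeasureTheory Filter

lemma aux_sinh_sq (u : ℝ) : u ^ 2 ≤ Real.sinh u ^ 2 := by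
  rcases le_total 0 u with h | h
  · have := Real.self_le_sinh_iff.2 h
    nlinarith
  · have := Real.sinh_le_self_iff.2 h
    nlinarith

lemma aux_cosh_ge (y : ℝ) : 1 + y ^ 2 ≤ Real.cosh (π * y) := by
  have h : Real.cosh (π * y) = 1 + 2 * Real.sinh (π * y / 2) ^ 2 := by
    have h1 := Real.cosh_two_mul (π * y / 2)
    have h2 := Real.cosh_sq (π * y / 2)
    rw [show 2 * (π * y / 2) = π * y by ring] at h1
    linarith
  have h3 := aux_sinh_sq (π * y / 2)
  have h4 : (3:ℝ) < π := Real.pi_gt_three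
  have h5 : 9 * y ^ 2 ≤ π ^ 2 * y ^ 2 := by
    apply mul_le_mul_of_nonneg_right _ (sq_nonneg y)
    nlinarith
  nlinarith [sq_nonneg y]

lemma aux_kernel (y : ℝ) : (1 + |y|) / Real.cosh (π * y) ^ 2 ≤ 2 * (1 + y ^ 2)⁻¹ := by
  have h := aux_cosh_ge y
  have h0 : 0 < 1 + y ^ 2 := by positivity
  have h1 : (1 + y ^ 2) ^ 2 ≤ Real.cosh (π * y) ^ 2 := by gcongr
  have h2 : 1 + |y| ≤ 2 * (1 + y ^ 2) := by nlinarith [sq_abs y, sq_nonneg (|y| - 1)]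
  calc (1 + |y|) / Real.cosh (π * y) ^ 2 ≤ (2 * (1 + y ^ 2)) / (1 + y ^ 2) ^ 2 := by
        gcongr
    _ = _ := by field_simp

lemma aux_int (f : ℝ → ℂ) (hf : Continuous f) (C : ℝ) (hC : ∀ y, ‖f y‖ ≤ C * (1 + |y|)) :
    Integrable (fun y : ℝ => f y / (Real.cosh (π * y) : ℂ) ^ 2) := by
  have hne : ∀ y : ℝ, (Real.cosh (π * y) : ℂ) ^ 2 ≠ 0 := fun y => by
    have := (Real.cosh_pos (π * y)).ne'
    exact pow_ne_zero _ (by exact_mod_cast this)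
  have hC0 : 0 ≤ C := by
    have := (norm_nonneg _).trans (hC 0)
    simpa using this
  refine Integrable.mono' ((integrable_inv_one_add_sq.const_mul 2).const_mul C) ?_ ?_
  · apply Continuous.aestronglyMeasurable
    refine hf.div ?_ hne
    have := Real.continuous_cosh
    fun_prop
  · refine Eventually.of_forall fun y => ?_
    rw [norm_div, norm_pow, Complex.norm_real, Real.norm_eq_abs, abs_of_pos (Real.cosh_pos _)]
    calc ‖f y‖ / Real.cosh (π * y) ^ 2 ≤ (C * (1 + |y|)) / Real.cosh (π * y) ^ 2 := by
          gcongr; exact hC y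
      _ = C * ((1 + |y|) / Real.cosh (π * y) ^ 2) := by ring
      _ ≤ _ := by gcongr; exact aux_kernel y

lemma aux_integral : ∫ y : ℝ, (1 : ℂ) / (Real.cosh (π * y) : ℂ) ^ 2 = 2 / π := by
  have hi := aux_int (fun _ => 1) continuous_const 1 (fun y => by simp)
  have key := integral_of_hasDerivAt_of_tendsto
    (f := fun y : ℝ => ((-(2 / π) * (Real.exp (2 * π * y) + 1)⁻¹ : ℝ) : ℂ))
    (f' := fun y : ℝ => (1 : ℂ) / (Real.cosh (π * y) : ℂ) ^ 2) (m := ((-(2 / π) : ℝ) : ℂ)) (n := 0)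
    ?_ hi ?_ ?_
  · rw [key]; push_cast; ring
  · intro y
    have h1 : HasDerivAt (fun y : ℝ => Real.exp (2 * π * y) + 1) (Real.exp (2 * π * y) * (2 * π)) y := by
      have := ((hasDerivAt_id y).const_mul (2 * π)).exp.add_const 1
      simpa using this
    have h2 := ((h1.inv (by positivity)).const_mul (-(2 / π))).ofReal_comp
    refine h2.congr_deriv ?_
    symm
    rw [show (1 : ℂ) / (Real.cosh (π * y) : ℂ) ^ 2 = ((1 / Real.cosh (π * y) ^ 2 : ℝ) : ℂ) by push_cast; rfl]
    congr 1
    rw [Real.cosh_eq, show 2 * π * y = π * y + π * y by ring, Real.exp_add, Real.exp_neg]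
    have := Real.exp_pos (π * y)
    field_simp
  · have : Tendsto (fun y : ℝ => -(2 / π) * (Real.exp (2 * π * y) + 1)⁻¹) atBot (nhds (-(2 / π) * (0 + 1)⁻¹)) := by
      refine Tendsto.const_mul _ (Tendsto.inv₀ (Tendsto.add_const _ ?_) (by norm_num))
      exact Real.tendsto_exp_atBot.comp (tendsto_id.const_mul_atBot (by positivity))
    have h2 := (Complex.continuous_ofReal.tendsto _).comp this
    rw [show -(2 / π) * (0 + 1 : ℝ)⁻¹ = -(2 / π) by norm_num] at h2
    exact h2
  · have : Tendsto (fun y : ℝ => -(2 / π) * (Real.exp (2 * π * y) + 1)⁻¹) atTop (nhds (-(2 / π) * 0)) := by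
      refine Tendsto.const_mul _ (Tendsto.inv_tendsto_atTop (tendsto_atTop_add_const_right _ _ ?_))
      exact Real.tendsto_exp_atTop.comp (tendsto_id.const_mul_atTop (by positivity))
    have h2 := (Complex.continuous_ofReal.tendsto _).comp this
    rw [mul_zero, Complex.ofReal_zero] at h2
    exact h2

lemma aux_sin_norm (z : ℂ) : |z.im| ≤ ‖Complex.sin z‖ := by
  have h1 : |Real.sinh z.im| ≤ ‖Complex.sin z‖ := by
    rw [Complex.sin, norm_div, norm_mul, Complex.norm_I]
    have := abs_norm_sub_norm_le (Complex.exp (-z * I)) (Complex.exp (z * I))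
    rw [Complex.norm_exp, Complex.norm_exp] at this
    rw [Real.sinh_eq, abs_div]
    simp at this ⊢
    linarith
  exact (sq_le_sq.1 (aux_sinh_sq z.im)).trans h1

lemma aux_cpow (s z : ℂ) (hs : 1 < s.re) (a : ℝ) (ha : 0 < a) (hz : a ≤ z.re) :
    ‖z ^ (1 - s)‖ ≤ a ^ (1 - s.re) * Real.exp (π * |s.im|) := by
  have h1 : a ≤ ‖z‖ := hz.trans (Complex.re_le_norm z)
  refine (Complex.norm_cpow_le _ _).trans ?_
  rw [div_eq_mul_inv, ← Real.exp_neg]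
  have h2 : -(z.arg * (1 - s).im) ≤ π * |s.im| := by
    refine (le_abs_self _).trans ?_
    rw [abs_neg, abs_mul]
    have : |(1 - s).im| = |s.im| := by simp
    rw [this]
    gcongr
    exact Complex.abs_arg_le_pi z
  have h3 : ‖z‖ ^ (1 - s).re ≤ a ^ (1 - s.re) := by
    rw [Complex.sub_re, Complex.one_re]
    exact Real.rpow_le_rpow_of_nonpos ha h1 (by linarith)
  gcongr

lemma aux_sin_half (N : ℕ) (y : ℝ) :
    Complex.sin (π * ((N : ℂ) + 1 / 2 + y * Complex.I)) ^ 2 = (Real.cosh (π * y) : ℂ) ^ 2 := by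
  have h : (π : ℂ) * ((N : ℂ) + 1 / 2 + y * Complex.I) = ((π * y : ℝ) * I + π / 2) + N * π := by
    push_cast; ring
  rw [h, Complex.sin_antiperiodic.add_nat_mul_eq, Complex.sin_add_pi_div_two, Complex.cos_mul_I, mul_pow,
    ← pow_mul, mul_comm N 2, pow_mul]
  simp

lemma aux_cont (s : ℂ) (a : ℂ) (ha : 0 < a.re) : Continuous (fun y : ℝ => (a + y * I) ^ (1 - s)) := by
  refine Continuous.cpow (by fun_prop) continuous_const fun y => ?_
  left; simpa using ha

lemma aux_limit (s : ℂ) (hs : 1 < s.re) :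
    Tendsto (fun N : ℕ =>
        ∫ y : ℝ, Complex.I *
          ((π : ℂ) ^ 2 * ((N : ℂ) + 1 / 2 + y * Complex.I) ^ (1 - s) /
            (Complex.sin (π * ((N : ℂ) + 1 / 2 + y * Complex.I))) ^ 2))
      atTop (nhds 0) := by
  have hb : ∀ N : ℕ, ‖∫ y : ℝ, Complex.I *
          ((π : ℂ) ^ 2 * ((N : ℂ) + 1 / 2 + y * Complex.I) ^ (1 - s) /
            (Complex.sin (π * ((N : ℂ) + 1 / 2 + y * Complex.I))) ^ 2)‖ ≤
      ((N : ℝ) + 1 / 2) ^ (-(s.re - 1)) * ∫ y : ℝ, π ^ 2 * Real.exp (π * |s.im|) * (2 * (1 + y ^ 2)⁻¹) := by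
    intro N
    rw [← integral_const_mul]
    refine norm_integral_le_of_norm_le
      (((integrable_inv_one_add_sq.const_mul 2).const_mul _).const_mul _) ?_
    refine Eventually.of_forall fun y => ?_
    rw [aux_sin_half, norm_mul, norm_div, norm_mul, Complex.norm_I, one_mul, norm_pow, norm_pow,
      Complex.norm_real, Complex.norm_real, Real.norm_eq_abs, Real.norm_eq_abs,
      abs_of_pos (Real.cosh_pos _), abs_of_pos Real.pi_pos]
    have h1 := aux_cpow s ((N : ℂ) + 1 / 2 + y * Complex.I) hs (N + 1 / 2) (by positivity) (by simp)
    have h2 := aux_kernel y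
    have h3 : 1 / Real.cosh (π * y) ^ 2 ≤ 2 * (1 + y ^ 2)⁻¹ := by
      refine le_trans ?_ h2
      gcongr
      linarith [abs_nonneg y]
    rw [neg_sub]
    calc _ = π ^ 2 * ‖((N : ℂ) + 1 / 2 + y * Complex.I) ^ (1 - s)‖ * (1 / Real.cosh (π * y) ^ 2) := by ring
      _ ≤ π ^ 2 * ((N + 1 / 2 : ℝ) ^ (1 - s.re) * Real.exp (π * |s.im|)) * (2 * (1 + y ^ 2)⁻¹) := by
        gcongr
      _ = _ := by ring
  refine squeeze_zero_norm hb ?_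
  have h := (tendsto_rpow_neg_atTop (y := s.re - 1) (by linarith)).comp
    (tendsto_atTop_add_const_right _ (1 / 2 : ℝ) tendsto_natCast_atTop_atTop)
  have := h.mul_const (∫ y : ℝ, π ^ 2 * Real.exp (π * |s.im|) * (2 * (1 + y ^ 2)⁻¹))
  rw [zero_mul] at this
  exact this

/-- Cauchy on the strip, remainder form. -/
lemma aux_cauchy (s : ℂ) (hs : 1 < s.re) (N : ℕ) (G' : ℂ) (F : ℂ → ℂ)
    (hF : DifferentiableOn ℂ F {z | |z.re - (N + 1)| < 1})
    (hFe : ∀ z : ℂ, z ≠ N + 1 → F z = (z ^ (1 - s) - ((N : ℂ) + 1) ^ (1 - s) - (z - (N + 1)) * G') /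
      Complex.sin (π * z) ^ 2) :
    ∫ y : ℝ, F ((N : ℂ) + 1 / 2 + y * I) = ∫ y : ℝ, F (((N + 1 : ℕ) : ℂ) + 1 / 2 + y * I) := by
  have hint : ∀ M : ℕ, Integrable (fun y : ℝ => F ((M : ℂ) + 1 / 2 + y * I)) := by
    intro M
    have e : (fun y : ℝ => F ((M : ℂ) + 1 / 2 + y * I)) = fun y : ℝ =>
        (((M : ℂ) + 1 / 2 + y * I) ^ (1 - s) - ((N : ℂ) + 1) ^ (1 - s) -
          (((M : ℂ) + 1 / 2 + y * I) - (N + 1)) * G') / (Real.cosh (π * y) : ℂ) ^ 2 := by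
      funext y
      rw [hFe, aux_sin_half]
      intro h
      have h1 := congrArg Complex.re h
      simp at h1
      have h2 : (2 * M + 1 : ℝ) = 2 * N + 2 := by linarith
      have h3 : 2 * M + 1 = 2 * N + 2 := by exact_mod_cast h2
      omega
    rw [e]
    have hc := aux_cont s ((M : ℂ) + 1 / 2) (by simp; positivity)
    refine aux_int _ (by fun_prop) ((1 / 2 : ℝ) ^ (1 - s.re) * Real.exp (π * |s.im|)
      + ‖((N : ℂ) + 1) ^ (1 - s)‖ + (‖(M : ℂ) + 1 / 2 - (N + 1)‖ + 1) * ‖G'‖) fun y => ?_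
    have h1 := aux_cpow s ((M : ℂ) + 1 / 2 + y * I) hs (1 / 2) (by norm_num) (by simp)
    have h2 : ‖((M : ℂ) + 1 / 2 + y * I) - (N + 1)‖ ≤ (‖(M : ℂ) + 1 / 2 - (N + 1)‖ + 1) * (1 + |y|) := by
      have : ((M : ℂ) + 1 / 2 + y * I) - (N + 1) = ((M : ℂ) + 1 / 2 - (N + 1)) + y * I := by ring
      rw [this]
      refine (norm_add_le _ _).trans ?_
      have h3 : ‖(y : ℂ) * I‖ = |y| := by simp
      rw [h3]
      nlinarith [abs_nonneg y, norm_nonneg ((M : ℂ) + 1 / 2 - (N + 1))]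
    refine (norm_sub_le _ _).trans ?_
    rw [norm_mul]
    have h4 := norm_sub_le (((M : ℂ) + 1 / 2 + y * I) ^ (1 - s)) (((N : ℂ) + 1) ^ (1 - s))
    have h5 := mul_le_mul_of_nonneg_right h2 (norm_nonneg G')
    have h6 : 0 ≤ ((1 / 2 : ℝ) ^ (1 - s.re) * Real.exp (π * |s.im|)
      + ‖((N : ℂ) + 1) ^ (1 - s)‖) * |y| := by positivity
    nlinarith
  set C : ℝ := (1 / 2 : ℝ) ^ (1 - s.re) * Real.exp (π * |s.im|) + ‖((N : ℂ) + 1) ^ (1 - s)‖ + ‖G'‖ with hC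
  have hC0 : 0 ≤ C := by positivity
  have hbd : ∀ x t : ℝ, 1 ≤ |t| → x ∈ Set.uIoc ((N : ℝ) + 1 / 2) (N + 3 / 2) →
      ‖F (x + t * I)‖ ≤ C * (2 * |t|⁻¹) := by
    intro x t ht hx
    rw [Set.uIoc_of_le (by linarith)] at hx
    have hx0 : (1 / 2 : ℝ) ≤ x := by
      have : (0 : ℝ) ≤ N := by positivity
      linarith [hx.1]
    rw [hFe, norm_div, norm_pow]
    · have h1 := aux_cpow s (x + t * I) hs (1 / 2) (by norm_num) (by simpa using hx0)
      have h2 : ‖(x + t * I : ℂ) - (N + 1)‖ ≤ 1 + |t| := by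
        have : (x + t * I : ℂ) - (N + 1) = ((x - (N + 1) : ℝ) : ℂ) + t * I := by push_cast; ring
        rw [this]
        refine (norm_add_le _ _).trans ?_
        have h3 : ‖(t : ℂ) * I‖ = |t| := by simp
        rw [h3, Complex.norm_real, Real.norm_eq_abs]
        have : |x - (N + 1)| ≤ 1 := by rw [abs_le]; constructor <;> linarith [hx.1, hx.2]
        linarith
      have h3 := aux_sin_norm (π * (x + t * I))
      have h3' : |t| ≤ ‖Complex.sin (π * (x + t * I))‖ := by
        refine le_trans ?_ h3
        simp only [Complex.mul_im, Complex.ofReal_re, Complex.ofReal_im, Complex.add_im,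
          Complex.I_re, Complex.I_im]
        simp only [mul_one, mul_zero, add_zero, zero_add, zero_mul, abs_mul]
        rw [abs_of_pos Real.pi_pos]
        nlinarith [Real.pi_gt_three, abs_nonneg t]
      have h4 : ‖(x + t * I : ℂ) ^ (1 - s) - ((N : ℂ) + 1) ^ (1 - s) - ((x + t * I) - (N + 1)) * G'‖
          ≤ C * (1 + |t|) := by
        refine (norm_sub_le _ _).trans ?_
        rw [norm_mul]
        have h4 := norm_sub_le ((x + t * I : ℂ) ^ (1 - s)) (((N : ℂ) + 1) ^ (1 - s))
        have h5 := mul_le_mul_of_nonneg_right h2 (norm_nonneg G')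
        have h6 : 0 ≤ ((1 / 2 : ℝ) ^ (1 - s.re) * Real.exp (π * |s.im|)
          + ‖((N : ℂ) + 1) ^ (1 - s)‖) * |t| := by positivity
        rw [hC]
        nlinarith
      have ht0 : 0 < |t| := by linarith
      calc _ ≤ (C * (1 + |t|)) / |t| ^ 2 := by gcongr
        _ ≤ (C * (2 * |t|)) / |t| ^ 2 := by gcongr; linarith
        _ = _ := by field_simp
    · intro h
      have h1 := congrArg Complex.im h
      simp at h1
      rw [h1] at ht; norm_num at ht
  have hrect : ∀ T : ℝ, ((∫ x : ℝ in ((N : ℝ) + 1 / 2)..(N + 3 / 2), F (x + (-T : ℝ) * I)) -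
      (∫ x : ℝ in ((N : ℝ) + 1 / 2)..(N + 3 / 2), F (x + T * I))) +
      I * (∫ y : ℝ in (-T)..T, F (((N + 1 : ℕ) : ℂ) + 1 / 2 + y * I)) -
      I * (∫ y : ℝ in (-T)..T, F ((N : ℂ) + 1 / 2 + y * I)) = 0 := by
    intro T
    have := Complex.integral_boundary_rect_eq_zero_of_differentiableOn F
      ⟨(N : ℝ) + 1 / 2, -T⟩ ⟨N + 3 / 2, T⟩ (hF.mono ?_)
    · simp only [smul_eq_mul] at this
      rw [← this]
      have e1 : (((N + 1 : ℕ) : ℂ) + 1 / 2) = (((N : ℝ) + 3 / 2 : ℝ) : ℂ) := by push_cast; ring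
      have e2 : ((N : ℂ) + 1 / 2) = (((N : ℝ) + 1 / 2 : ℝ) : ℂ) := by push_cast; ring
      rw [e1, e2]
    · intro z hz
      have := hz.1
      simp only [Set.mem_preimage] at this
      rw [Set.uIcc_of_le (by linarith)] at this
      rw [Set.mem_ofPred_eq, abs_lt]
      constructor <;> linarith [this.1, this.2]
  have hz0 : Tendsto (fun T : ℝ => C * (2 * |T|⁻¹) * |(N : ℝ) + 3 / 2 - (N + 1 / 2)|) atTop (nhds 0) := by
    have h := ((tendsto_abs_atTop_atTop.inv_tendsto_atTop.const_mul (2:ℝ)).const_mul C).mul_const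
      |(N : ℝ) + 3 / 2 - (N + 1 / 2)|
    simpa using h
  have hz1 : Tendsto (fun T : ℝ => ∫ x : ℝ in ((N : ℝ) + 1 / 2)..(N + 3 / 2), F (x + T * I)) atTop (nhds 0) := by
    refine squeeze_zero_norm' ?_ hz0
    filter_upwards [eventually_ge_atTop 1] with T hT
    refine intervalIntegral.norm_integral_le_of_norm_le_const fun x hx => hbd x T ?_ hx
    rwa [abs_of_pos (by linarith)]
  have hz2 : Tendsto (fun T : ℝ => ∫ x : ℝ in ((N : ℝ) + 1 / 2)..(N + 3 / 2), F (x + (-T : ℝ) * I)) atTop (nhds 0) := by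
    refine squeeze_zero_norm' ?_ hz0
    filter_upwards [eventually_ge_atTop 1] with T hT
    refine intervalIntegral.norm_integral_le_of_norm_le_const fun x hx => ?_
    have := hbd x (-T) (by rw [abs_neg]; rwa [abs_of_pos (by linarith)]) hx
    rwa [abs_neg] at this
  have hv := fun M => intervalIntegral_tendsto_integral (hint M) tendsto_neg_atTop_atBot tendsto_id
  have hlim := ((hz2.sub hz1).add ((hv (N + 1)).const_mul I)).sub ((hv N).const_mul I)
  have hlim2 := (tendsto_congr hrect).1 hlim
  have h := tendsto_nhds_unique hlim2 tendsto_const_nhds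
  have h' : I * (∫ y : ℝ, F (((N + 1 : ℕ) : ℂ) + 1 / 2 + y * I)) =
      I * ∫ y : ℝ, F ((N : ℂ) + 1 / 2 + y * I) := by
    linear_combination h
  exact (mul_left_cancel₀ Complex.I_ne_zero h').symm

lemma aux_F (s : ℂ) (N : ℕ) : ∃ F : ℂ → ℂ,
    DifferentiableOn ℂ F {z | |z.re - (N + 1)| < 1} ∧
    ∀ z : ℂ, z ≠ N + 1 → F z = (z ^ (1 - s) - ((N : ℂ) + 1) ^ (1 - s) -
      (z - (N + 1)) * ((1 - s) * ((N : ℂ) + 1) ^ (-s))) / Complex.sin (π * z) ^ 2 := by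
  set n : ℂ := (N : ℂ) + 1 with hn
  set U : Set ℂ := {z | |z.re - (N + 1)| < 1} with hU
  have hUo : IsOpen U := isOpen_lt (by fun_prop) continuous_const
  have hnU : U ∈ nhds n := hUo.mem_nhds (by simp [hU, hn])
  have hpos : ∀ z ∈ U, 0 < z.re := by
    intro z hz
    rw [hU, Set.mem_ofPred_eq, abs_lt] at hz
    have : (0 : ℝ) ≤ N := by positivity
    linarith [hz.1]
  have hGd : ∀ z : ℂ, 0 < z.re → HasDerivAt (fun z : ℂ => z ^ (1 - s)) ((1 - s) * z ^ (-s)) z := by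
    intro z hz
    have := (hasDerivAt_id z).cpow_const (c := 1 - s) (Or.inl hz)
    simpa using this
  have hsn : Complex.sin (π * n) = 0 := by
    rw [Complex.sin_eq_zero_iff]
    exact ⟨N + 1, by push_cast; rw [hn]; ring⟩
  have hSd : Differentiable ℂ (fun z : ℂ => Complex.sin (π * z)) := by fun_prop
  refine ⟨fun z => dslope (dslope (fun z : ℂ => z ^ (1 - s)) n) n z /
    (dslope (fun z : ℂ => Complex.sin (π * z)) n z) ^ 2, ?_, ?_⟩
  · refine DifferentiableOn.div ?_ ?_ ?_
    · rw [Complex.differentiableOn_dslope hnU, Complex.differentiableOn_dslope hnU]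
      exact fun z hz => (hGd z (hpos z hz)).differentiableAt.differentiableWithinAt
    · refine DifferentiableOn.pow ?_ 2
      rw [Complex.differentiableOn_dslope hnU]
      exact hSd.differentiableOn
    · intro z hz
      refine pow_ne_zero _ ?_
      by_cases h : z = n
      · rw [h, dslope_same]
        have hd : HasDerivAt (fun z : ℂ => Complex.sin (π * z)) (Complex.cos (π * n) * π) n := by
          have := ((hasDerivAt_id n).const_mul (π : ℂ)).csin
          simpa using this
        rw [hd.deriv]
        refine mul_ne_zero ?_ (by exact_mod_cast Real.pi_ne_zero)
        intro hc
        have := Complex.sin_sq_add_cos_sq (π * n)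
        rw [hsn, hc] at this
        norm_num at this
      · rw [dslope_of_ne _ h, slope_def_field, hsn, sub_zero]
        refine div_ne_zero ?_ (sub_ne_zero.2 h)
        intro hc
        rw [Complex.sin_eq_zero_iff] at hc
        obtain ⟨k, hk⟩ := hc
        have hpi : (π : ℂ) ≠ 0 := by exact_mod_cast Real.pi_ne_zero
        have hzk : z = k := mul_left_cancel₀ hpi (by rw [hk]; ring)
        apply h
        rw [hU, Set.mem_ofPred_eq, hzk, Complex.intCast_re] at hz
        have hz' : |k - ((N : ℤ) + 1)| < 1 := by exact_mod_cast hz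
        rw [Int.abs_lt_one_iff] at hz'
        rw [hzk, hn, show k = (N : ℤ) + 1 by omega]
        push_cast; rfl
  · intro z hz
    have hz' : z - n ≠ 0 := sub_ne_zero.2 hz
    simp only
    rw [dslope_of_ne _ hz, dslope_of_ne _ hz, slope_def_field, slope_def_field, dslope_same,
      dslope_of_ne _ hz, slope_def_field, hsn, sub_zero, (hGd n (by simp [hn]; positivity)).deriv]
    by_cases hS : Complex.sin (π * z) = 0
    · simp [hS]
    · field_simp

lemma aux_step (s : ℂ) (hs : 1 < s.re) (N : ℕ) :
    (∫ y : ℝ, ((N : ℂ) + 1 / 2 + y * I) ^ (1 - s) / (Real.cosh (π * y) : ℂ) ^ 2) -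
    (∫ y : ℝ, (((N + 1 : ℕ) : ℂ) + 1 / 2 + y * I) ^ (1 - s) / (Real.cosh (π * y) : ℂ) ^ 2) =
    (2 / π) * ((s - 1) * ((N : ℂ) + 1) ^ (-s)) := by
  obtain ⟨F, hF, hFe⟩ := aux_F s N
  have h := aux_cauchy s hs N _ F hF hFe
  set G' := (1 - s) * ((N : ℂ) + 1) ^ (-s) with hG'
  set A := ((N : ℂ) + 1) ^ (1 - s) with hA
  have hG : ∀ M : ℕ, Integrable (fun y : ℝ => ((M : ℂ) + 1 / 2 + y * I) ^ (1 - s) / (Real.cosh (π * y) : ℂ) ^ 2) := by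
    intro M
    refine aux_int _ (aux_cont s ((M : ℂ) + 1 / 2) (by simp; positivity))
      ((1 / 2 : ℝ) ^ (1 - s.re) * Real.exp (π * |s.im|)) fun y => ?_
    have h1 := aux_cpow s ((M : ℂ) + 1 / 2 + y * I) hs (1 / 2) (by norm_num) (by simp)
    refine h1.trans (le_mul_of_one_le_right (by positivity) (by linarith [abs_nonneg y]))
  have hQ : Integrable (fun y : ℝ => (A + y * I * G') / (Real.cosh (π * y) : ℂ) ^ 2) := by
    refine aux_int _ (by fun_prop) (‖A‖ + ‖G'‖) fun y => ?_
    refine (norm_add_le _ _).trans ?_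
    have : ‖(y : ℂ) * I * G'‖ = |y| * ‖G'‖ := by simp
    rw [this]
    nlinarith [norm_nonneg A, norm_nonneg G', abs_nonneg y, mul_nonneg (norm_nonneg A) (abs_nonneg y)]
  have hone := aux_int (fun _ => 1) continuous_const 1 (fun y => by simp)
  have hM : ∀ M : ℕ, ∫ y : ℝ, F ((M : ℂ) + 1 / 2 + y * I) =
      (∫ y : ℝ, ((M : ℂ) + 1 / 2 + y * I) ^ (1 - s) / (Real.cosh (π * y) : ℂ) ^ 2) -
      (∫ y : ℝ, (A + y * I * G') / (Real.cosh (π * y) : ℂ) ^ 2) - (M - N - 1 / 2) * G' * (2 / π) := by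
    intro M
    rw [← aux_integral, ← integral_const_mul, ← integral_sub (hG M) hQ,
      ← integral_sub (by exact (hG M).sub hQ) (hone.const_mul _)]
    congr 1
    funext y
    rw [hFe, aux_sin_half]
    · ring
    · intro h
      have h1 := congrArg Complex.re h
      simp at h1
      have h2 : (2 * M + 1 : ℝ) = 2 * N + 2 := by linarith
      have h3 : 2 * M + 1 = 2 * N + 2 := by exact_mod_cast h2
      omega
  rw [hM N, hM (N + 1)] at h
  push_cast at h ⊢
  linear_combination h

theorem stmt_18 (s : ℂ) (hs : 1 < s.re) :
    (∀ N : ℕ, 1 ≤ N →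
      (1 / (2 * π * Complex.I)) *
        ((∫ y : ℝ, Complex.I *
            ((π : ℂ) ^ 2 * ((1 / 2 : ℂ) + y * Complex.I) ^ (1 - s) /
              (Complex.sin (π * ((1 / 2 : ℂ) + y * Complex.I))) ^ 2)) -
          (∫ y : ℝ, Complex.I *
            ((π : ℂ) ^ 2 * ((N : ℂ) + 1 / 2 + y * Complex.I) ^ (1 - s) /
              (Complex.sin (π * ((N : ℂ) + 1 / 2 + y * Complex.I))) ^ 2))) =
        (s - 1) * ∑ n ∈ Finset.range N, ((n : ℂ) + 1) ^ (-s)) ∧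
    Tendsto (fun N : ℕ =>
        ∫ y : ℝ, Complex.I *
          ((π : ℂ) ^ 2 * ((N : ℂ) + 1 / 2 + y * Complex.I) ^ (1 - s) /
            (Complex.sin (π * ((N : ℂ) + 1 / 2 + y * Complex.I))) ^ 2))
      atTop (nhds 0) := by
  refine ⟨fun N _ => ?_, aux_limit s hs⟩
  have hE : ∀ M : ℕ, (∫ y : ℝ, Complex.I *
            ((π : ℂ) ^ 2 * ((M : ℂ) + 1 / 2 + y * Complex.I) ^ (1 - s) /
              (Complex.sin (π * ((M : ℂ) + 1 / 2 + y * Complex.I))) ^ 2)) =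
      I * π ^ 2 * ∫ y : ℝ, ((M : ℂ) + 1 / 2 + y * I) ^ (1 - s) / (Real.cosh (π * y) : ℂ) ^ 2 := by
    intro M
    rw [← integral_const_mul]
    congr 1
    funext y
    rw [aux_sin_half]
    ring
  have hsum : ∀ N : ℕ, (∫ y : ℝ, (((0 : ℕ) : ℂ) + 1 / 2 + y * I) ^ (1 - s) / (Real.cosh (π * y) : ℂ) ^ 2) -
    (∫ y : ℝ, ((N : ℂ) + 1 / 2 + y * I) ^ (1 - s) / (Real.cosh (π * y) : ℂ) ^ 2) =
    (2 / π) * ((s - 1) * ∑ n ∈ Finset.range N, ((n : ℂ) + 1) ^ (-s)) := by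
    intro N
    induction N with
    | zero => simp
    | succ k ih =>
      rw [Finset.sum_range_succ]
      linear_combination ih + aux_step s hs k
  have h0 := hE 0
  have hs' := hsum N
  rw [hE N]
  simp only [Nat.cast_zero, zero_add] at h0 hs'
  rw [h0, ← mul_sub, hs']
  have hpi : (π : ℂ) ≠ 0 := by exact_mod_cast Real.pi_ne_zero
  field_simp
end
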